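/- In Version C, a position with exactly four piles, whose pile sizes listed in nondecreasing order are a₁ ≤ a₂ ≤ a₃ ≤ a₄, is a P-position if and only if the parity pattern (a₁, a₂, a₃, a₄) mod 2 is either (even, even, even, even) or (even, odd, odd, odd). -/

import Mathlib

/-- Remove one token from a pile of size `p` in `G`: delete one copy of `p` and,
if `p ≠ 1`, add back a pile of size `p - 1`. -/
def takeOne (G : Multiset ℕ) (p : ℕ) : Multiset ℕ :=
  G.erase p + (if p = 1 then (0 : Multiset ℕ) else {p - 1})

/-- Legal moves of Version C: remove one token from one chosen pile, or choose two
piles (counted with multiplicity) and remove one token from each of them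
(piles reaching size 0 are deleted). -/
inductive MoveC : Multiset ℕ → Multiset ℕ → Prop
  | one {G : Multiset ℕ} {p : ℕ} (hp : p ∈ G) (h1 : 1 ≤ p) : MoveC G (takeOne G p)
  | two {G : Multiset ℕ} {p q : ℕ} (hp : p ∈ G) (hq : q ∈ G.erase p)
      (h1 : 1 ≤ p) (h2 : 1 ≤ q) : MoveC G (takeOne (takeOne G p) q)

mutual
  /-- P-positions of Version C under normal play: every move leads to an N-position
  (in particular the empty position is a P-position).  Since every move strictly
  decreases the total number of tokens, this inductive definition agrees with the
  usual recursive definition of outcome classes. -/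
  inductive PPosC : Multiset ℕ → Prop
    | mk : ∀ {G : Multiset ℕ}, (∀ H, MoveC G H → NPosC H) → PPosC G
  /-- N-positions of Version C under normal play: some move leads to a P-position. -/
  inductive NPosC : Multiset ℕ → Prop
    | mk : ∀ {G H : Multiset ℕ}, MoveC G H → PPosC H → NPosC G
end

/-- The nonempty piles of a position that may contain empty piles. -/
def nonemptyPiles (G : Multiset ℕ) : Multiset ℕ := G.filter (· ≠ 0)

/-- The candidate P-positions with four (possibly empty) piles: either every pile is even, or
exactly three piles are odd and every even pile is smaller than every odd pile. -/
def EvenOrThreeOdd (G : Multiset ℕ) : Prop :=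
  G.countP Odd = 0 ∨ (G.countP Odd = 3 ∧ ∀ e ∈ G, Even e → ∀ x ∈ G, Odd x → e < x)

/-- Moves between positions whose exhausted piles are kept as empty piles. -/
inductive PaddedMove : Multiset ℕ → Multiset ℕ → Prop
  | one {p : ℕ} (K : Multiset ℕ) (hp : 1 ≤ p) : PaddedMove (p ::ₘ K) ((p - 1) ::ₘ K)
  | two {p q : ℕ} (K : Multiset ℕ) (hp : 1 ≤ p) (hq : 1 ≤ q) :
      PaddedMove (p ::ₘ q ::ₘ K) ((p - 1) ::ₘ (q - 1) ::ₘ K)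

theorem takeOne_nonemptyPiles_cons {p : ℕ} (K : Multiset ℕ) (hp : 1 ≤ p) :
    takeOne (nonemptyPiles (p ::ₘ K)) p = nonemptyPiles ((p - 1) ::ₘ K) := by
  have h0 : p ≠ 0 := by omega
  by_cases h : p = 1
  · simp [takeOne, nonemptyPiles, h]
  · have h2 : p - 1 ≠ 0 := by omega
    simp [takeOne, nonemptyPiles, h, h0, h2, add_comm]

theorem takeOne_takeOne_nonemptyPiles {p q : ℕ} (K : Multiset ℕ) (hp : 1 ≤ p) (hq : 1 ≤ q) :
    takeOne (takeOne (nonemptyPiles (p ::ₘ q ::ₘ K)) p) q =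
      nonemptyPiles ((p - 1) ::ₘ (q - 1) ::ₘ K) := by
  rw [takeOne_nonemptyPiles_cons _ hp, Multiset.cons_swap, takeOne_nonemptyPiles_cons _ hq,
    Multiset.cons_swap]

theorem mem_nonemptyPiles {p : ℕ} {G : Multiset ℕ} : p ∈ nonemptyPiles G ↔ p ∈ G ∧ p ≠ 0 := by
  simp [nonemptyPiles]

theorem PaddedMove.moveC {G H : Multiset ℕ} (h : PaddedMove G H) :
    MoveC (nonemptyPiles G) (nonemptyPiles H) := by
  cases h with
  | @one p K hp =>
    rw [← takeOne_nonemptyPiles_cons K hp]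
    exact .one (by simp [mem_nonemptyPiles]; omega) hp
  | @two p q K hp hq =>
    rw [← takeOne_takeOne_nonemptyPiles K hp hq]
    have h0 : p ≠ 0 := by omega
    have h1 : q ≠ 0 := by omega
    exact .two (by simp [mem_nonemptyPiles, h0]) (by simp [nonemptyPiles, h0, h1]) hp hq

theorem exists_paddedMove_of_moveC {G H : Multiset ℕ} (h : MoveC (nonemptyPiles G) H) :
    ∃ G', PaddedMove G G' ∧ H = nonemptyPiles G' := by
  cases h with
  | @one p hp h1 =>
    obtain ⟨K, rfl⟩ := Multiset.exists_cons_of_mem (mem_nonemptyPiles.1 hp).1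
    exact ⟨_, .one K h1, takeOne_nonemptyPiles_cons K h1⟩
  | @two p q hp hq h1 h2 =>
    obtain ⟨K, rfl⟩ := Multiset.exists_cons_of_mem (mem_nonemptyPiles.1 hp).1
    have hK : q ∈ K := by
      have h0 : p ≠ 0 := by omega
      simp [nonemptyPiles, h0] at hq
      exact hq.1
    obtain ⟨K, rfl⟩ := Multiset.exists_cons_of_mem hK
    exact ⟨_, .two K h1 h2, takeOne_takeOne_nonemptyPiles K h1 h2⟩

theorem PaddedMove.card_eq {G H : Multiset ℕ} (h : PaddedMove G H) : H.card = G.card := by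
  cases h <;> simp

theorem PaddedMove.sum_lt {G H : Multiset ℕ} (h : PaddedMove G H) : H.sum < G.sum := by
  cases h <;> simp <;> omega

theorem evenOrThreeOdd_quadruple_iff (a b c d : ℕ) :
    EvenOrThreeOdd (a ::ₘ b ::ₘ {c, d}) ↔
      (a % 2 = 0 ∧ b % 2 = 0 ∧ c % 2 = 0 ∧ d % 2 = 0) ∨
      (a % 2 = 0 ∧ b % 2 = 1 ∧ c % 2 = 1 ∧ d % 2 = 1 ∧ a < b ∧ a < c ∧ a < d) ∨
      (a % 2 = 1 ∧ b % 2 = 0 ∧ c % 2 = 1 ∧ d % 2 = 1 ∧ b < a ∧ b < c ∧ b < d) ∨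
      (a % 2 = 1 ∧ b % 2 = 1 ∧ c % 2 = 0 ∧ d % 2 = 1 ∧ c < a ∧ c < b ∧ c < d) ∨
      (a % 2 = 1 ∧ b % 2 = 1 ∧ c % 2 = 1 ∧ d % 2 = 0 ∧ d < a ∧ d < b ∧ d < c) := by
  have hcd : ({c, d} : Multiset ℕ) = c ::ₘ d ::ₘ 0 := rfl
  rw [EvenOrThreeOdd, hcd]
  simp only [Multiset.countP_cons, Multiset.countP_zero, Nat.odd_iff, Nat.even_iff]
  rcases Nat.mod_two_eq_zero_or_one a with ha | ha <;>
  rcases Nat.mod_two_eq_zero_or_one b with hb | hb <;>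
  rcases Nat.mod_two_eq_zero_or_one c with hc | hc <;>
  rcases Nat.mod_two_eq_zero_or_one d with hd | hd <;>
  simp [ha, hb, hc, hd]

theorem PaddedMove.not_evenOrThreeOdd {G H : Multiset ℕ} (h : PaddedMove G H) (hG : G.card = 4)
    (hb : EvenOrThreeOdd G) : ¬ EvenOrThreeOdd H := by
  cases h with
  | @one p K hp =>
    obtain ⟨b, c, d, rfl⟩ := Multiset.card_eq_three.1 (by simpa using hG : K.card = 3)
    rw [Multiset.insert_eq_cons, evenOrThreeOdd_quadruple_iff] at hb ⊢
    omega
  | @two p q K hp hq =>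
    obtain ⟨c, d, rfl⟩ := Multiset.card_eq_two.1 (by simpa using hG : K.card = 2)
    rw [evenOrThreeOdd_quadruple_iff] at hb ⊢
    omega

theorem exists_min_odd {G : Multiset ℕ} (h : ∃ x ∈ G, Odd x) :
    ∃ p ∈ G, Odd p ∧ ∀ x ∈ G, Odd x → p ≤ x := by
  classical
  obtain ⟨hm, ho⟩ := Nat.find_spec h
  exact ⟨Nat.find h, hm, ho, fun x hx hxo => Nat.find_min' h ⟨hx, hxo⟩⟩

theorem exists_paddedMove_evenOrThreeOdd {G : Multiset ℕ} (hG : G.card = 4)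
    (hb : ¬ EvenOrThreeOdd G) :
    ∃ H, PaddedMove G H ∧ EvenOrThreeOdd H := by
  have hodd : ∃ x ∈ G, Odd x := by
    by_contra! hne
    exact hb (.inl (Multiset.countP_eq_zero.2 fun x hx => by simpa using hne x hx))
  obtain ⟨p, hp, hpo, hmin⟩ := exists_min_odd hodd
  obtain ⟨K, rfl⟩ := Multiset.exists_cons_of_mem hp
  obtain ⟨b, c, d, rfl⟩ := Multiset.card_eq_three.1 (by simpa using hG : K.card = 3)
  have hpb : b % 2 = 1 → p ≤ b := fun h => hmin b (by simp) (Nat.odd_iff.2 h)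
  have hpc : c % 2 = 1 → p ≤ c := fun h => hmin c (by simp) (Nat.odd_iff.2 h)
  have hpd : d % 2 = 1 → p ≤ d := fun h => hmin d (by simp) (Nat.odd_iff.2 h)
  rw [Nat.odd_iff] at hpo
  have hone : PaddedMove (p ::ₘ b ::ₘ {c, d}) ((p - 1) ::ₘ b ::ₘ {c, d}) := .one _ (by omega)
  have htwo_b (h : 1 ≤ b) :
      PaddedMove (p ::ₘ b ::ₘ {c, d}) ((p - 1) ::ₘ (b - 1) ::ₘ {c, d}) :=
    .two _ (by omega) h
  have htwo_c (h : 1 ≤ c) :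
      PaddedMove (p ::ₘ b ::ₘ {c, d}) ((p - 1) ::ₘ (c - 1) ::ₘ {b, d}) := by
    have : b ::ₘ {c, d} = c ::ₘ ({b, d} : Multiset ℕ) := Multiset.cons_swap b c {d}
    rw [this]
    exact .two _ (by omega) h
  have htwo_d (h : 1 ≤ d) :
      PaddedMove (p ::ₘ b ::ₘ {c, d}) ((p - 1) ::ₘ (d - 1) ::ₘ {b, c}) := by
    have : b ::ₘ {c, d} = d ::ₘ ({b, c} : Multiset ℕ) := by
      rw [Multiset.pair_comm c d]
      exact Multiset.cons_swap b d {c}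
    rw [this]
    exact .two _ (by omega) h
  rw [Multiset.insert_eq_cons] at hb ⊢
  simp only [evenOrThreeOdd_quadruple_iff] at hb
  have hp' : (p - 1) % 2 = 0 := by omega
  have hpred (n : ℕ) (hn : 1 ≤ n) : (n - 1) % 2 = 1 - n % 2 := by omega
  rcases Nat.mod_two_eq_zero_or_one b with hb2 | hb2 <;>
  rcases Nat.mod_two_eq_zero_or_one c with hc2 | hc2 <;>
  rcases Nat.mod_two_eq_zero_or_one d with hd2 | hd2 <;>
  simp only [hpo, hb2, hc2, hd2, true_and, false_and, and_false, one_ne_zero, zero_ne_one,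
    or_false, false_or, forall_const, IsEmpty.forall_iff] at hb hpb hpc hpd <;>
  first
  | refine ⟨_, hone, (evenOrThreeOdd_quadruple_iff ..).2 ?_⟩
    simp [hp', hb2, hc2, hd2] <;> omega
  | have h : 1 ≤ b := by omega
    refine ⟨_, htwo_b h, (evenOrThreeOdd_quadruple_iff ..).2 ?_⟩
    simp [hp', hpred, h, hb2, hc2, hd2] <;> omega
  | have h : 1 ≤ c := by omega
    refine ⟨_, htwo_c h, (evenOrThreeOdd_quadruple_iff ..).2 ?_⟩
    simp [hp', hpred, h, hb2, hc2, hd2] <;> omega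
  | have h : 1 ≤ d := by omega
    refine ⟨_, htwo_d h, (evenOrThreeOdd_quadruple_iff ..).2 ?_⟩
    simp [hp', hpred, h, hb2, hc2, hd2] <;> omega

theorem outcome_nonemptyPiles (G : Multiset ℕ) (hG : G.card = 4) :
    (PPosC (nonemptyPiles G) ↔ EvenOrThreeOdd G) ∧
      (NPosC (nonemptyPiles G) ↔ ¬ EvenOrThreeOdd G) := by
  induction hn : G.sum using Nat.strong_induction_on generalizing G with
  | _ n ih =>
  subst hn
  have ih' {H : Multiset ℕ} (h : PaddedMove G H) := ih _ h.sum_lt H (h.card_eq.trans hG) rfl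
  refine ⟨⟨fun hP => ?_, fun hb => ⟨fun H hH => ?_⟩⟩, fun hN hb => ?_, fun hb => ?_⟩
  · by_contra hb
    obtain ⟨H, hm, hH⟩ := exists_paddedMove_evenOrThreeOdd hG hb
    obtain ⟨hP⟩ := hP
    exact (ih' hm).2.1 (hP _ hm.moveC) hH
  · obtain ⟨G', hm, rfl⟩ := exists_paddedMove_of_moveC hH
    exact (ih' hm).2.2 (hm.not_evenOrThreeOdd hG hb)
  · obtain ⟨hmove, hP⟩ := hN
    obtain ⟨G', hm, rfl⟩ := exists_paddedMove_of_moveC hmove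
    exact hm.not_evenOrThreeOdd hG hb ((ih' hm).1.1 hP)
  · obtain ⟨H, hm, hH⟩ := exists_paddedMove_evenOrThreeOdd hG hb
    exact .mk hm.moveC ((ih' hm).1.2 hH)

/-- In Version C, a four-pile position with pile sizes listed in nondecreasing order
`a1 ≤ a2 ≤ a3 ≤ a4` is a P-position iff the parity pattern is
(even, even, even, even) or (even, odd, odd, odd). -/
theorem versionC_four_piles (a1 a2 a3 a4 : ℕ) (h1 : 1 ≤ a1)
    (h12 : a1 ≤ a2) (h23 : a2 ≤ a3) (h34 : a3 ≤ a4) :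
    PPosC {a1, a2, a3, a4} ↔
      (Even a1 ∧ Even a2 ∧ Even a3 ∧ Even a4) ∨
      (Even a1 ∧ Odd a2 ∧ Odd a3 ∧ Odd a4) := by
  have hpos : nonemptyPiles {a1, a2, a3, a4} = {a1, a2, a3, a4} := by
    refine Multiset.filter_eq_self.2 fun x hx => ?_
    simp at hx
    omega
  rw [← hpos, (outcome_nonemptyPiles _ (by simp)).1, Multiset.insert_eq_cons,
    Multiset.insert_eq_cons, evenOrThreeOdd_quadruple_iff]
  simp only [Nat.even_iff, Nat.odd_iff]
  rcases Nat.mod_two_eq_zero_or_one a1 with ha | ha <;>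
  rcases Nat.mod_two_eq_zero_or_one a2 with hb | hb <;>
  rcases Nat.mod_two_eq_zero_or_one a3 with hc | hc <;>
  rcases Nat.mod_two_eq_zero_or_one a4 with hd | hd <;>
  simp [ha, hb, hc, hd] <;>
  omega
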